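/- arXiv:2511.10181 — 2 statements merged into one kernel-verified Lean document; each statement's English description precedes it below -/
import Mathlib

section
/- Let θ₀ > 0 and let τ₀ := inf{t ∈ ℕ : S_{0,t} ≥ θ₀}. Under any adaptive adversary strategy for H₀ (law ℙ), the expected stopping time is finite: E_ℙ[τ₀] < ∞. Symmetrically, for θ₁ > 0 and τ₁ := inf{t ∈ ℕ : S_{1,t} ≥ θ₁}, under any adaptive adversary strategy for H₁ (law ℚ), E_ℚ[τ₁] < ∞. -/
open scoped BigOperators ENNReal

variable {𝒳 : Type*}

/-- A probability mass function on the finite alphabet `𝒳`. -/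
def IsDist [Fintype 𝒳] (f : 𝒳 → ℝ) : Prop :=
  (∀ x, 0 ≤ f x) ∧ ∑ x, f x = 1

/-- Kullback–Leibler divergence `D(p‖q) = ∑ₓ p(x) log (p(x)/q(x))`. -/
noncomputable def KL [Fintype 𝒳] (p q : 𝒳 → ℝ) : ℝ :=
  ∑ x, p x * Real.log (p x / q x)

/-- Probability of observing the finite sequence `l` under the adaptive strategy `str`:
`ℙ(x^t) = ∏ᵢ str(x^{i-1})(xᵢ)`. -/
noncomputable def seqProb [Fintype 𝒳] (str : List 𝒳 → 𝒳 → ℝ) (l : List 𝒳) : ℝ :=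
  ∏ i : Fin l.length, str (l.take i.1) (l.get i)

/-- Log-likelihood-ratio sum `S_t = ∑ᵢ log (p(xᵢ)/q(xᵢ))`. -/
noncomputable def llSum (p q : 𝒳 → ℝ) (l : List 𝒳) : ℝ :=
  ∑ i : Fin l.length, Real.log (p (l.get i) / q (l.get i))

/-- An adaptive adversary strategy choosing, after each history, a distribution in `P`. -/
def IsStrategy (P : Set (𝒳 → ℝ)) (str : List 𝒳 → 𝒳 → ℝ) : Prop :=
  ∀ l, str l ∈ P

open Classical in
/-- Probability that the first `n` observations form a sequence satisfying `E`. -/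
noncomputable def probAt [Fintype 𝒳] (str : List 𝒳 → 𝒳 → ℝ) (n : ℕ)
    (E : List 𝒳 → Prop) : ℝ :=
  ∑ x : Fin n → 𝒳, if E (List.ofFn x) then seqProb str (List.ofFn x) else 0

/-- No prefix of `l` (including `l` itself) lies in the stopping region `B`;
for `l` of length `n` this is the event `{τ_B > n}`. -/
def notYet (B : List 𝒳 → Prop) (l : List 𝒳) : Prop :=
  ∀ t ≤ l.length, ¬ B (l.take t)

/-- `l` is a stopped sequence of the first-hitting time `τ_B` of the region `B`. -/
def stopsAt (B : List 𝒳 → Prop) (l : List 𝒳) : Prop :=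
  B l ∧ ∀ t < l.length, ¬ B (l.take t)

/-- Expected stopping time `E[τ_B] = ∑_{n ≥ 0} ℙ(τ_B > n)`, valued in `ℝ≥0∞`. -/
noncomputable def expTau [Fintype 𝒳] (str : List 𝒳 → 𝒳 → ℝ) (B : List 𝒳 → Prop) : ℝ≥0∞ :=
  ∑' n : ℕ, ENNReal.ofReal (probAt str n (notYet B))

open Classical in
/-- Expectation of `f` evaluated at the stopped sequence `X^{τ_B}`. -/
noncomputable def expStopped [Fintype 𝒳] (str : List 𝒳 → 𝒳 → ℝ) (B : List 𝒳 → Prop)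
    (f : List 𝒳 → ℝ) : ℝ :=
  ∑' l : List 𝒳, if stopsAt B l then seqProb str l * f l else 0

open Classical in
/-- Probability that the process stops (via `B`) at a sequence satisfying `E`. -/
noncomputable def probStopIn [Fintype 𝒳] (str : List 𝒳 → 𝒳 → ℝ) (B : List 𝒳 → Prop)
    (E : List 𝒳 → Prop) : ℝ :=
  ∑' l : List 𝒳, if stopsAt B l ∧ E l then seqProb str l else 0

lemma seqProb_append_singleton [Fintype 𝒳] (str : List 𝒳 → 𝒳 → ℝ) (l : List 𝒳) (a : 𝒳) :
    seqProb str (l ++ [a]) = seqProb str l * str l a := by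
  have h : l.length + 1 = (l ++ [a]).length := by simp
  unfold seqProb
  rw [← Fin.prod_congr' _ h, Fin.prod_univ_castSucc]
  congr 1
  · refine Finset.prod_congr rfl fun i _ => ?_
    simp [List.take_append_of_le_length i.2.le]
  · simp

lemma llSum_append_singleton (p q : 𝒳 → ℝ) (l : List 𝒳) (a : 𝒳) :
    llSum p q (l ++ [a]) = llSum p q l + Real.log (p a / q a) := by
  have h : l.length + 1 = (l ++ [a]).length := by simp
  unfold llSum
  rw [← Fin.sum_congr' _ h, Fin.sum_univ_castSucc]
  congr 1
  · refine Finset.sum_congr rfl fun i _ => ?_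
    simp
  · simp

lemma seqProb_nonneg [Fintype 𝒳] {str : List 𝒳 → 𝒳 → ℝ} (h : ∀ l x, 0 ≤ str l x)
    (l : List 𝒳) : 0 ≤ seqProb str l :=
  Finset.prod_nonneg fun _ _ => h _ _

/-- Exponential moments of an adaptive process whose conditional moments are at most `ρ`. -/
lemma sum_seqProb_mul_exp_le [Fintype 𝒳] {str : List 𝒳 → 𝒳 → ℝ} (hstr : ∀ l x, 0 ≤ str l x)
    (p q : 𝒳 → ℝ) {s ρ : ℝ} (hρ : 0 ≤ ρ)
    (h : ∀ l, ∑ x, str l x * Real.exp (-(s * Real.log (p x / q x))) ≤ ρ) (n : ℕ) :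
    ∑ x : Fin n → 𝒳, seqProb str (List.ofFn x) * Real.exp (-(s * llSum p q (List.ofFn x)))
      ≤ ρ ^ n := by
  induction n with
  | zero =>
    have h1 : seqProb str [] = 1 := Fin.prod_univ_zero _
    have h2 : llSum p q [] = 0 := Fin.sum_univ_zero _
    simp [h1, h2]
  | succ n ih =>
    rw [← (Fin.snocEquiv fun _ : Fin (n + 1) => 𝒳).sum_comp, Fintype.sum_prod_type_right]
    have key : ∀ y : Fin n → 𝒳, ∑ a : 𝒳,
        seqProb str (List.ofFn (Fin.snocEquiv (fun _ : Fin (n + 1) => 𝒳) (a, y))) *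
          Real.exp (-(s * llSum p q
            (List.ofFn (Fin.snocEquiv (fun _ : Fin (n + 1) => 𝒳) (a, y))))) ≤
        seqProb str (List.ofFn y) * Real.exp (-(s * llSum p q (List.ofFn y))) * ρ := by
      intro y
      have hsnoc : ∀ a : 𝒳, List.ofFn (Fin.snocEquiv (fun _ : Fin (n + 1) => 𝒳) (a, y)) =
          List.ofFn y ++ [a] := by
        intro a
        rw [List.ofFn_succ', List.concat_eq_append]
        simp [Fin.snocEquiv]
      refine le_trans (le_of_eq ?_) (mul_le_mul_of_nonneg_left (h (List.ofFn y))
        (mul_nonneg (seqProb_nonneg hstr _) (Real.exp_pos _).le))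
      rw [Finset.mul_sum]
      refine Finset.sum_congr rfl fun a _ => ?_
      rw [hsnoc, seqProb_append_singleton, llSum_append_singleton, mul_add, neg_add, Real.exp_add]
      ring
    refine (Finset.sum_le_sum fun y _ => key y).trans ?_
    rw [← Finset.sum_mul, pow_succ]
    exact mul_le_mul_of_nonneg_right ih hρ

lemma probAt_notYet_le [Fintype 𝒳] {str : List 𝒳 → 𝒳 → ℝ} (hstr : ∀ l x, 0 ≤ str l x)
    (p q : 𝒳 → ℝ) {s ρ : ℝ} (hs : 0 ≤ s) (hρ : 0 ≤ ρ)
    (h : ∀ l, ∑ x, str l x * Real.exp (-(s * Real.log (p x / q x))) ≤ ρ) (θ : ℝ) (n : ℕ) :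
    probAt str n (notYet fun l => θ ≤ llSum p q l) ≤ Real.exp (s * θ) * ρ ^ n := by
  refine le_trans ?_ (mul_le_mul_of_nonneg_left (sum_seqProb_mul_exp_le hstr p q hρ h n)
    (Real.exp_pos _).le)
  rw [probAt, Finset.mul_sum]
  refine Finset.sum_le_sum fun x _ => ?_
  have hw := seqProb_nonneg hstr (List.ofFn x)
  split_ifs with hx
  · have hlt : llSum p q (List.ofFn x) < θ := by
      simpa only [List.take_length, not_le] using hx _ le_rfl
    have h1 : 1 ≤ Real.exp (s * θ) * Real.exp (-(s * llSum p q (List.ofFn x))) := by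
      rw [← Real.exp_add]
      exact Real.one_le_exp (by nlinarith)
    nlinarith
  · positivity

/-- A uniformly positive conditional drift of the log-likelihood ratio makes the expected
hitting time of any level finite. -/
lemma expTau_ne_top_of_drift [Fintype 𝒳] {str : List 𝒳 → 𝒳 → ℝ} (hstr : ∀ l, IsDist (str l))
    (p q : 𝒳 → ℝ) {d : ℝ} (hd : 0 < d)
    (hdrift : ∀ l, d ≤ ∑ x, str l x * Real.log (p x / q x)) (θ : ℝ) :
    expTau str (fun l => θ ≤ llSum p q l) ≠ ⊤ := by
  set L : 𝒳 → ℝ := fun x => Real.log (p x / q x) with hL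
  set M : ℝ := 1 + d + ∑ x, |L x| with hM
  have hsum : 0 ≤ ∑ x, |L x| := Finset.sum_nonneg fun _ _ => abs_nonneg _
  have hM0 : 0 < M := by positivity
  have hLM : ∀ x, |L x| ≤ M := fun x => by
    have := Finset.single_le_sum (f := fun x => |L x|) (fun _ _ => abs_nonneg _)
      (Finset.mem_univ x)
    linarith
  set s : ℝ := d / (2 * M ^ 2) with hs
  have hs0 : 0 < s := by positivity
  have hsM : s * M ≤ 1 := by
    rw [hs, div_mul_eq_mul_div, div_le_one (by positivity)]
    nlinarith
  have hsd : s * M ^ 2 = d / 2 := by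
    rw [hs]; field_simp
  have hmoment : ∀ l, ∑ x, str l x * Real.exp (-(s * L x)) ≤ 1 - s * d / 2 := by
    intro l
    have hterm : ∀ x, str l x * Real.exp (-(s * L x)) ≤
        str l x * (1 + s ^ 2 * M ^ 2) - s * (str l x * L x) := by
      intro x
      have habs : |-(s * L x)| ≤ 1 := by
        rw [abs_neg, abs_mul, abs_of_pos hs0]
        exact (mul_le_mul_of_nonneg_left (hLM x) hs0.le).trans hsM
      have h1 := (abs_le.1 (Real.abs_exp_sub_one_sub_id_le habs)).2
      have h2 : L x ^ 2 ≤ M ^ 2 := sq_le_sq.2 (by rw [abs_of_pos hM0]; exact hLM x)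
      have h3 : Real.exp (-(s * L x)) ≤ 1 + s ^ 2 * M ^ 2 - s * L x := by
        nlinarith [mul_le_mul_of_nonneg_left h2 (sq_nonneg s)]
      have := mul_le_mul_of_nonneg_left h3 ((hstr l).1 x)
      linarith
    refine (Finset.sum_le_sum fun x _ => hterm x).trans ?_
    rw [Finset.sum_sub_distrib, ← Finset.sum_mul, ← Finset.mul_sum, (hstr l).2]
    have h4 := mul_le_mul_of_nonneg_left (hdrift l) hs0.le
    have h5 : s ^ 2 * M ^ 2 = s * d / 2 := by rw [pow_two, mul_assoc, hsd]; ring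
    linarith
  have hρ0 : 0 ≤ 1 - s * d / 2 :=
    (Finset.sum_nonneg fun x _ => mul_nonneg ((hstr []).1 x) (Real.exp_pos _).le).trans
      (hmoment [])
  have hρ1 : 1 - s * d / 2 < 1 := by
    have := mul_pos hs0 hd
    linarith
  have hbound := probAt_notYet_le (fun l => (hstr l).1) p q hs0.le hρ0 hmoment θ
  have hsummable : Summable fun n : ℕ => Real.exp (s * θ) * (1 - s * d / 2) ^ n :=
    (summable_geometric_of_lt_one hρ0 hρ1).mul_left _
  exact ne_top_of_le_ne_top hsummable.tsum_ofReal_ne_top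
    (ENNReal.tsum_le_tsum fun n => ENNReal.ofReal_le_ofReal (hbound n))

lemma KL_pos [Fintype 𝒳] {p q : 𝒳 → ℝ} (hp : IsDist p) (hq : IsDist q)
    (hac : ∀ x, p x = 0 ↔ q x = 0) (hne : p ≠ q) : 0 < KL p q := by
  have hle : ∀ x, p x - q x ≤ p x * Real.log (p x / q x) ∧
      (p x ≠ q x → p x - q x < p x * Real.log (p x / q x)) := by
    intro x
    by_cases h0 : p x = 0
    · simp [h0, (hac x).1 h0]
    have hpx : 0 < p x := lt_of_le_of_ne (hp.1 x) (Ne.symm h0)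
    have hqx : 0 < q x := lt_of_le_of_ne (hq.1 x) fun h => h0 ((hac x).2 h.symm)
    have hinv : Real.log (p x / q x) = -Real.log (q x / p x) := by
      rw [← Real.log_inv, inv_div]
    have hmul : p x * (q x / p x) = q x := by field_simp
    rw [hinv]
    refine ⟨?_, fun hx => ?_⟩
    · have := mul_le_mul_of_nonneg_left (Real.log_le_sub_one_of_pos (div_pos hqx hpx)) hpx.le
      linarith
    · have h1 : q x / p x ≠ 1 := fun h => hx ((div_eq_one_iff_eq hpx.ne').1 h).symm
      have := mul_lt_mul_of_pos_left (Real.log_lt_sub_one_of_pos (div_pos hqx hpx) h1) hpx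
      linarith
  obtain ⟨x, hx⟩ := Function.ne_iff.1 hne
  have := Finset.sum_lt_sum (fun x _ => (hle x).1) ⟨x, Finset.mem_univ x, (hle x).2 hx⟩
  rw [Finset.sum_sub_distrib, hp.2, hq.2, sub_self] at this
  exact this

/-- The variational inequality behind the Pythagorean theorem for information projections. -/
lemma KL_le_sum_mul_log [Fintype 𝒳] {P : Set (𝒳 → ℝ)} (hP : ∀ p ∈ P, IsDist p)
    (hPconv : Convex ℝ P) {p₀ q₀ : 𝒳 → ℝ} (hp₀ : p₀ ∈ P) (hq₀ : IsDist q₀)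
    (hac : ∀ p ∈ P, ∀ x, (p x = 0 ↔ q₀ x = 0)) (hmin : ∀ p ∈ P, KL p₀ q₀ ≤ KL p q₀)
    {p : 𝒳 → ℝ} (hp : p ∈ P) :
    KL p₀ q₀ ≤ ∑ x, p x * Real.log (p₀ x / q₀ x) := by
  set C : ℝ := ∑ x, (p x - p₀ x) ^ 2 / p₀ x with hC
  have hC0 : 0 ≤ C := Finset.sum_nonneg fun x _ => div_nonneg (sq_nonneg _) ((hP _ hp₀).1 x)
  set A : ℝ := ∑ x, p x * Real.log (p₀ x / q₀ x) with hA
  have hstep : ∀ ε : ℝ, 0 < ε → ε ≤ 1 → KL p₀ q₀ ≤ A + ε * C := by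
    intro ε hε hε1
    have hr : (1 - ε) • p₀ + ε • p ∈ P :=
      hPconv hp₀ hp (by linarith) hε.le (by ring)
    have hterm : ∀ x, ((1 - ε) • p₀ + ε • p) x *
          Real.log (((1 - ε) • p₀ + ε • p) x / q₀ x) ≤
        ε ^ 2 * ((p x - p₀ x) ^ 2 / p₀ x) + ε * (p x - p₀ x) +
          ((1 - ε) * (p₀ x * Real.log (p₀ x / q₀ x)) +
            ε * (p x * Real.log (p₀ x / q₀ x))) := by
      intro x
      by_cases h0 : q₀ x = 0
      · simp [h0, (hac _ hp x).2 h0, (hac _ hp₀ x).2 h0]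
      have hq : 0 < q₀ x := lt_of_le_of_ne (hq₀.1 x) (Ne.symm h0)
      have hp0 : 0 < p₀ x := lt_of_le_of_ne ((hP _ hp₀).1 x) fun h =>
        h0 ((hac _ hp₀ x).1 h.symm)
      have hrx : 0 < ((1 - ε) • p₀ + ε • p) x := lt_of_le_of_ne ((hP _ hr).1 x) fun h =>
        h0 ((hac _ hr x).1 h.symm)
      have hval : ((1 - ε) • p₀ + ε • p) x = p₀ x + ε * (p x - p₀ x) := by
        simp only [Pi.add_apply, Pi.smul_apply, smul_eq_mul]
        ring
      rw [hval] at hrx ⊢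
      set r : ℝ := p₀ x + ε * (p x - p₀ x) with hr_def
      have hlog : Real.log (r / q₀ x) = Real.log (r / p₀ x) + Real.log (p₀ x / q₀ x) := by
        rw [← Real.log_mul (by positivity) (by positivity)]
        congr 1
        field_simp
      have h1 := mul_le_mul_of_nonneg_left
        (Real.log_le_sub_one_of_pos (div_pos hrx hp0)) hrx.le
      have h2 : r * (r / p₀ x - 1) =
          ε ^ 2 * ((p x - p₀ x) ^ 2 / p₀ x) + ε * (p x - p₀ x) := by
        rw [hr_def]
        field_simp
        ring
      have h3 : r * Real.log (p₀ x / q₀ x) = (1 - ε) * (p₀ x * Real.log (p₀ x / q₀ x)) +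
          ε * (p x * Real.log (p₀ x / q₀ x)) := by
        rw [hr_def]
        ring
      rw [hlog, mul_add]
      linarith
    have hle := (hmin _ hr).trans (Finset.sum_le_sum fun x _ => hterm x)
    simp only [Finset.sum_add_distrib, ← Finset.mul_sum, Finset.sum_sub_distrib,
      (hP _ hp).2, (hP _ hp₀).2] at hle
    rw [← hC, ← hA] at hle
    change KL p₀ q₀ ≤ _ + ((1 - ε) * KL p₀ q₀ + _) at hle
    have : 0 ≤ ε * (A + ε * C - KL p₀ q₀) := by linarith
    have := nonneg_of_mul_nonneg_right this hε
    linarith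
  refine le_of_forall_pos_le_add fun δ hδ => ?_
  have hε : 0 < min 1 (δ / (C + 1)) := by positivity
  refine (hstep _ hε (min_le_left _ _)).trans ?_
  have h1 : min 1 (δ / (C + 1)) * C ≤ δ / (C + 1) * (C + 1) :=
    mul_le_mul (min_le_right _ _) (by linarith) hC0 (by positivity)
  rw [div_mul_cancel₀ _ (by positivity)] at h1
  linarith

lemma expTau_ne_top_of_KL_minimizer [Fintype 𝒳] {P Q : Set (𝒳 → ℝ)}
    (hP : ∀ p ∈ P, IsDist p) (hQ : ∀ q ∈ Q, IsDist q) (hPconv : Convex ℝ P)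
    (hdisj : Disjoint P Q) (hac : ∀ p ∈ P, ∀ q ∈ Q, ∀ x, (p x = 0 ↔ q x = 0))
    {p₀ q₀ : 𝒳 → ℝ} (hp₀ : p₀ ∈ P) (hq₀ : q₀ ∈ Q)
    (hmin : ∀ p ∈ P, ∀ q ∈ Q, KL p₀ q₀ ≤ KL p q)
    {str : List 𝒳 → 𝒳 → ℝ} (hstr : IsStrategy P str) (θ : ℝ) :
    expTau str (fun l => θ ≤ llSum p₀ q₀ l) ≠ ⊤ :=
  expTau_ne_top_of_drift (fun l => hP _ (hstr l)) p₀ q₀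
    (KL_pos (hP _ hp₀) (hQ _ hq₀) (hac _ hp₀ _ hq₀) (hdisj.ne_of_mem hp₀ hq₀))
    (fun l => KL_le_sum_mul_log hP hPconv hp₀ (hQ _ hq₀) (fun p hp => hac p hp _ hq₀)
      (fun p hp => hmin p hp _ hq₀) (hstr l)) θ

/-- For `θ₀ > 0` and `τ₀ = inf{t : S_{0,t} ≥ θ₀}`, under any adaptive
adversary strategy for `H₀` (law `ℙ`) we have `E_ℙ[τ₀] < ∞`; symmetrically, for `θ₁ > 0`
and `τ₁ = inf{t : S_{1,t} ≥ θ₁}`, under any adaptive adversary strategy for `H₁` (law `ℚ`)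
we have `E_ℚ[τ₁] < ∞`. -/
theorem stmt5 [Fintype 𝒳] [Nonempty 𝒳]
    (P Q : Set (𝒳 → ℝ))
    (hP : ∀ p ∈ P, IsDist p) (hQ : ∀ q ∈ Q, IsDist q)
    (hPclosed : IsClosed P) (hQclosed : IsClosed Q)
    (hPconv : Convex ℝ P) (hQconv : Convex ℝ Q)
    (hdisj : Disjoint P Q)
    (hac : ∀ p ∈ P, ∀ q ∈ Q, ∀ x, (p x = 0 ↔ q x = 0))
    (p₀ q₀ : 𝒳 → ℝ) (hp₀ : p₀ ∈ P) (hq₀ : q₀ ∈ Q)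
    (hmin₀ : ∀ p ∈ P, ∀ q ∈ Q, KL p₀ q₀ ≤ KL p q)
    (p₁ q₁ : 𝒳 → ℝ) (hp₁ : p₁ ∈ P) (hq₁ : q₁ ∈ Q)
    (hmin₁ : ∀ p ∈ P, ∀ q ∈ Q, KL q₁ p₁ ≤ KL q p)
    (strP strQ : List 𝒳 → 𝒳 → ℝ)
    (hstrP : IsStrategy P strP) (hstrQ : IsStrategy Q strQ)
    (θ₀ θ₁ : ℝ) (hθ₀ : 0 < θ₀) (hθ₁ : 0 < θ₁) :
    expTau strP (fun l => θ₀ ≤ llSum p₀ q₀ l) ≠ ⊤ ∧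
    expTau strQ (fun l => θ₁ ≤ llSum q₁ p₁ l) ≠ ⊤ := by
  exact ⟨expTau_ne_top_of_KL_minimizer hP hQ hPconv hdisj hac hp₀ hq₀ hmin₀ hstrP θ₀,
    expTau_ne_top_of_KL_minimizer hQ hP hQconv hdisj.symm
      (fun q hq p hp x => (hac p hp q hq x).symm) hq₁ hp₁
      (fun q hq p hp => hmin₁ p hp q hq) hstrQ θ₁⟩
end

section
/- Let θ₀ > 0 and τ₀ := inf{t ∈ ℕ : S_{0,t} ≥ θ₀}. Under any adaptive adversary strategy for H₁ (law ℚ), E_ℚ[2^{S_{0,τ₀}}] ≤ 1. -/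
open scoped BigOperators ENNReal

variable {𝒳 : Type*}

/-- Kullback–Leibler divergence with base-2 logarithms. -/
noncomputable def KL2 [Fintype 𝒳] (p q : 𝒳 → ℝ) : ℝ :=
  ∑ x, p x * Real.logb 2 (p x / q x)

/-- Log-likelihood-ratio sum `S_t` with base-2 logarithms. -/
noncomputable def llSum2 (p q : 𝒳 → ℝ) (l : List 𝒳) : ℝ :=
  ∑ i : Fin l.length, Real.logb 2 (p (l.get i) / q (l.get i))

/-- Peeling off the first observation of `seqProb`. -/
theorem seqProb_cons [Fintype 𝒳] (str : List 𝒳 → 𝒳 → ℝ) (x : 𝒳) (l : List 𝒳) :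
    seqProb str (x :: l) = str [] x * seqProb (fun m => str (x :: m)) l := by
  unfold seqProb
  simp [Fin.prod_univ_succ]

/-- Kraft's inequality: a prefix-free set of sequences of bounded length has total weight at most
one under any sub-probability strategy. -/
theorem sum_seqProb_le_one_of_length_le [Fintype 𝒳] (n : ℕ) (str : List 𝒳 → 𝒳 → ℝ)
    (hnonneg : ∀ l x, 0 ≤ str l x) (hsum : ∀ l, ∑ x, str l x ≤ 1) (s : Finset (List 𝒳))
    (hlen : ∀ l ∈ s, l.length ≤ n) (hprefix : ∀ l ∈ s, ∀ m ∈ s, l <+: m → l = m) :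
    ∑ l ∈ s, seqProb str l ≤ 1 := by
  classical
  induction n generalizing str s with
  | zero =>
    have hs : s ⊆ {[]} := fun l hl => by simpa using hlen l hl
    refine (Finset.sum_le_sum_of_subset_of_nonneg hs fun l _ _ =>
      Finset.prod_nonneg fun i _ => hnonneg _ _).trans ?_
    simp
  | succ n ih =>
    by_cases hnil : [] ∈ s
    · have hs : s = {[]} := Finset.eq_singleton_iff_unique_mem.2
        ⟨hnil, fun l hl => (hprefix [] hnil l hl List.nil_prefix).symm⟩
      simp [hs, seqProb]
    · let tails (x : 𝒳) : Finset (List 𝒳) := s.preimage (x :: ·) (List.cons_injective.injOn)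
      have hdecomp : ∑ l ∈ s, seqProb str l = ∑ x, ∑ l ∈ tails x, seqProb str (x :: l) := by
        rw [Finset.sum_sigma']
        symm
        refine Finset.sum_bij (fun a _ => a.1 :: a.2) ?_ ?_ ?_ ?_
        · intro a ha
          simpa [tails] using ha
        · rintro ⟨x, l⟩ _ ⟨y, m⟩ _ h
          simpa using h
        · intro l hl
          cases l with
          | nil => exact absurd hl hnil
          | cons x l => exact ⟨⟨x, l⟩, by simpa [tails] using hl, rfl⟩
        · intros
          rfl
      rw [hdecomp]
      refine le_trans (Finset.sum_le_sum fun x _ => ?_) (hsum [])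
      simp only [seqProb_cons, ← Finset.mul_sum]
      refine mul_le_of_le_one_right (hnonneg _ _) (ih _ (fun _ => hnonneg _) (fun _ => hsum _)
        (tails x) (fun l hl => ?_) (fun l hl m hm h => ?_))
      · simpa using hlen (x :: l) (by simpa [tails] using hl)
      · simpa using hprefix (x :: l) (by simpa [tails] using hl) (x :: m)
          (by simpa [tails] using hm) (by simpa using h)

/-- Stopped sequences of a hitting time are prefix-free. -/
theorem stopsAt.eq_of_prefix {B : List 𝒳 → Prop} {l m : List 𝒳} (hl : stopsAt B l)
    (hm : stopsAt B m) (h : l <+: m) : l = m := by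
  by_contra hne
  have hlt : l.length < m.length :=
    lt_of_le_of_ne h.length_le fun he => hne (h.eq_of_length he)
  exact hm.2 _ hlt (List.prefix_iff_eq_take.1 h ▸ hl.1)

open Classical in
/-- A stopped sub-probability strategy has total weight at most one. -/
theorem tsum_stopsAt_seqProb_le_one [Fintype 𝒳] (str : List 𝒳 → 𝒳 → ℝ)
    (hnonneg : ∀ l x, 0 ≤ str l x) (hsum : ∀ l, ∑ x, str l x ≤ 1) (B : List 𝒳 → Prop) :
    ∑' l, (if stopsAt B l then seqProb str l else 0) ≤ 1 := by
  refine Real.tsum_le_of_sum_le (fun l => ?_) fun s => ?_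
  · split_ifs
    exacts [Finset.prod_nonneg fun i _ => hnonneg _ _, le_rfl]
  · rw [← Finset.sum_filter]
    refine sum_seqProb_le_one_of_length_le (s.sup List.length) str hnonneg hsum _
      (fun l hl => Finset.le_sup (Finset.mem_filter.1 hl).1) fun l hl m hm h => ?_
    exact (Finset.mem_filter.1 hl).2.eq_of_prefix (Finset.mem_filter.1 hm).2 h

/-- Exponentiating the log-likelihood ratio turns the sequence probability into a product of
reweighted conditional probabilities. -/
theorem seqProb_mul_two_rpow_llSum2 [Fintype 𝒳] {str : List 𝒳 → 𝒳 → ℝ} {p q : 𝒳 → ℝ}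
    (hp : ∀ x, 0 ≤ p x) (hq : ∀ x, 0 ≤ q x) (hpq : ∀ x, p x = 0 ↔ q x = 0)
    (hstr : ∀ l x, p x = 0 → str l x = 0) (l : List 𝒳) :
    seqProb str l * (2 : ℝ) ^ llSum2 p q l = seqProb (fun m x => str m x * (p x / q x)) l := by
  unfold seqProb llSum2
  rw [Real.rpow_sum_of_pos two_pos, ← Finset.prod_mul_distrib]
  refine Finset.prod_congr rfl fun i _ => ?_
  by_cases h : p (l.get i) = 0
  · simp only [hstr _ _ h, zero_mul]
  · have hp' := (hp _).lt_of_ne' h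
    have hq' := (hq _).lt_of_ne' (mt (hpq _).2 h)
    rw [Real.rpow_logb two_pos (by norm_num) (div_pos hp' hq')]

/-- First-order optimality of the reverse information projection: if `q` minimizes `KL2 p` over
a convex set of distributions with the support of `p`, then `p / q` has mean at most one under
every element of this set. -/
theorem sum_mul_div_le_one_of_KL2_min [Fintype 𝒳] {Q : Set (𝒳 → ℝ)} (hQconv : Convex ℝ Q)
    {p q r : 𝒳 → ℝ} (hp : IsDist p) (hQ : ∀ q ∈ Q, IsDist q)
    (hac : ∀ q ∈ Q, ∀ x, (p x = 0 ↔ q x = 0)) (hq : q ∈ Q) (hr : r ∈ Q)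
    (hmin : ∀ q' ∈ Q, KL2 p q ≤ KL2 p q') :
    ∑ x, r x * (p x / q x) ≤ 1 := by
  let ρ (x : 𝒳) : ℝ := r x / q x - 1
  have hbound : ∀ t ∈ Set.Ioo (0 : ℝ) 1, ∑ x, p x * (ρ x / (1 + t * ρ x)) ≤ 0 := by
    rintro t ⟨ht0, ht1⟩
    have hmem : (1 - t) • q + t • r ∈ Q := hQconv hq hr (by linarith) ht0.le (by ring)
    have hterm : ∀ x, p x * (ρ x / (1 + t * ρ x)) * (t / Real.log 2) ≤
        p x * Real.logb 2 (p x / q x) -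
          p x * Real.logb 2 (p x / ((1 - t) • q + t • r) x) := by
      intro x
      by_cases h : p x = 0
      · simp [h]
      have hpx := (hp.1 x).lt_of_ne' h
      have hqx := ((hQ q hq).1 x).lt_of_ne' (mt (hac q hq x).2 h)
      have hrx := ((hQ r hr).1 x).lt_of_ne' (mt (hac r hr x).2 h)
      have hmix : ((1 - t) • q + t • r) x = q x * (1 + t * ρ x) := by
        simp only [Pi.add_apply, Pi.smul_apply, smul_eq_mul, ρ]
        field_simp
        ring
      have hpos : 0 < 1 + t * ρ x := by
        have : 1 + t * ρ x = (1 - t) + t * (r x / q x) := by simp only [ρ]; ring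
        rw [this]
        have := div_pos hrx hqx
        nlinarith [mul_pos ht0 this]
      rw [hmix, ← mul_sub, mul_assoc]
      refine mul_le_mul_of_nonneg_left ?_ hpx.le
      have hlog := Real.one_sub_inv_le_log_of_pos hpos
      have heq : Real.logb 2 (p x / q x) - Real.logb 2 (p x / (q x * (1 + t * ρ x))) =
          Real.log (1 + t * ρ x) / Real.log 2 := by
        simp only [Real.logb]
        rw [Real.log_div hpx.ne' hqx.ne', Real.log_div hpx.ne' (mul_pos hqx hpos).ne',
          Real.log_mul hqx.ne' hpos.ne']
        ring
      rw [heq, mul_div_assoc']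
      refine div_le_div_of_nonneg_right (le_trans (le_of_eq ?_) hlog)
        (Real.log_pos one_lt_two).le
      rw [div_mul_eq_mul_div, eq_sub_iff_add_eq, inv_eq_one_div, ← add_div,
        div_eq_one_iff_eq hpos.ne']
      ring
    have hsum := Finset.sum_le_sum fun x (_ : x ∈ Finset.univ) => hterm x
    rw [← Finset.sum_mul, Finset.sum_sub_distrib] at hsum
    have hle : KL2 p q ≤ _ := hmin _ hmem
    unfold KL2 at hle
    have hc : 0 < t / Real.log 2 := div_pos ht0 (Real.log_pos one_lt_two)
    exact nonpos_of_mul_nonpos_left (hsum.trans (sub_nonpos.2 hle)) hc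
  have hlim : Filter.Tendsto (fun t : ℝ => ∑ x, p x * (ρ x / (1 + t * ρ x)))
      (nhdsWithin 0 (Set.Ioi 0)) (nhds (∑ x, p x * ρ x)) := by
    have hcont : ContinuousAt (fun t : ℝ => ∑ x, p x * (ρ x / (1 + t * ρ x))) 0 := by
      fun_prop (disch := simp)
    simpa using hcont.tendsto.mono_left nhdsWithin_le_nhds
  have hderiv : ∑ x, p x * ρ x ≤ 0 :=
    le_of_tendsto hlim (Filter.eventually_of_mem (Ioo_mem_nhdsGT one_pos) hbound)
  have hexpand : ∑ x, p x * ρ x = ∑ x, r x * (p x / q x) - 1 := by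
    rw [← hp.2, ← Finset.sum_sub_distrib]
    exact Finset.sum_congr rfl fun x _ => by simp only [ρ]; ring
  linarith

/-- For `θ₀ > 0` and `τ₀ = inf{t : S_{0,t} ≥ θ₀}` (base-2 logarithms),
under any adaptive adversary strategy for `H₁` (law `ℚ`), `E_ℚ[2^{S_{0,τ₀}}] ≤ 1`. -/
theorem stmt9 [Fintype 𝒳] [Nonempty 𝒳]
    (P Q : Set (𝒳 → ℝ))
    (hP : ∀ p ∈ P, IsDist p) (hQ : ∀ q ∈ Q, IsDist q)
    (hPclosed : IsClosed P) (hQclosed : IsClosed Q)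
    (hPconv : Convex ℝ P) (hQconv : Convex ℝ Q)
    (hdisj : Disjoint P Q)
    (hac : ∀ p ∈ P, ∀ q ∈ Q, ∀ x, (p x = 0 ↔ q x = 0))
    (p₀ q₀ : 𝒳 → ℝ) (hp₀ : p₀ ∈ P) (hq₀ : q₀ ∈ Q)
    (hmin₀ : ∀ p ∈ P, ∀ q ∈ Q, KL2 p₀ q₀ ≤ KL2 p q)
    (strQ : List 𝒳 → 𝒳 → ℝ) (hstrQ : IsStrategy Q strQ)
    (θ₀ : ℝ) (hθ₀ : 0 < θ₀) :
    expStopped strQ (fun l => θ₀ ≤ llSum2 p₀ q₀ l)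
      (fun l => (2 : ℝ) ^ llSum2 p₀ q₀ l) ≤ 1 := by
  have hdist := hQ _ hq₀
  have hsub : ∀ x, p₀ x = 0 ↔ q₀ x = 0 := hac p₀ hp₀ q₀ hq₀
  unfold expStopped
  simp only [seqProb_mul_two_rpow_llSum2 (hP _ hp₀).1 hdist.1 hsub
    fun l x => (hac p₀ hp₀ _ (hstrQ l) x).1]
  refine tsum_stopsAt_seqProb_le_one _ (fun l x => mul_nonneg ((hQ _ (hstrQ l)).1 x)
    (div_nonneg ((hP _ hp₀).1 x) (hdist.1 x))) (fun l => ?_) _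
  exact sum_mul_div_le_one_of_KL2_min hQconv (hP _ hp₀) hQ (hac p₀ hp₀) hq₀ (hstrQ l)
    (hmin₀ p₀ hp₀)
end
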